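/- Let Θ = Alt(Or₁ ∪ Or₂) : (S¹×S¹)⁵ → ℝ. If x₀,…,x₄ are points of S¹ positively cyclically ordered according to their numbering and y₀,…,y₄ are points of S¹ positively cyclically ordered according to their numbering, then Θ((x₀,y₀),(x₁,y₂),(x₂,y₄),(x₃,y₁),(x₄,y₃)) = 2/3. Consequently the sup norm of Θ equals 2/3. -/

import Mathlib

open scoped BigOperators

/-- Orientation cocycle on the circle: +1 for positively oriented (counterclockwise)
triples of distinct points, -1 for negatively oriented triples, 0 if two coincide. -/
noncomputable def orient (a b c : Circle) : ℝ :=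
  Real.sign (((starRingEnd ℂ) ((b : ℂ) - (a : ℂ)) * ((c : ℂ) - (a : ℂ))).im)

/-- `x 0, …, x (n-1)` are positively cyclically ordered according to their numbering. -/
def PosCyclicallyOrdered {n : ℕ} (x : Fin n → Circle) : Prop :=
  ∀ i j k : Fin n, i < j → j < k → orient (x i) (x j) (x k) = 1

/-- Θ = Alt(Or₁ ∪ Or₂). -/
noncomputable def Theta (z : Fin 5 → Circle × Circle) : ℝ :=
  (1 / 120) * ∑ σ : Equiv.Perm (Fin 5),
    ((Equiv.Perm.sign σ : ℤ) : ℝ) *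
      (orient (z (σ 0)).1 (z (σ 1)).1 (z (σ 2)).1 *
        orient (z (σ 2)).2 (z (σ 3)).2 (z (σ 4)).2)


/-- In coordinates, `orient k p q` is the sign of a scaled difference of stereographic
coordinates based at `k`. -/
lemma orient_stereo (k : Circle) : ∃ P t : Circle → ℝ, (∀ p, 0 ≤ P p) ∧
    ∀ p q, orient k p q = Real.sign (P p * P q * (t p - t q)) := by
  have hc : ∀ p : Circle, (p : ℂ).re ^ 2 + (p : ℂ).im ^ 2 = 1 := by
    intro p
    have h := Circle.normSq_coe p
    rw [Complex.normSq_apply] at h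
    linarith
  set P : Circle → ℝ := fun p => 1 - ((k : ℂ).re * (p : ℂ).re + (k : ℂ).im * (p : ℂ).im) with hP
  set Q : Circle → ℝ := fun p => (k : ℂ).re * (p : ℂ).im - (k : ℂ).im * (p : ℂ).re with hQ
  have hPQ : ∀ p, (1 - P p) ^ 2 + Q p ^ 2 = 1 := by
    intro p
    have h1 := hc p
    have h2 := hc k
    simp only [hP, hQ]
    linear_combination ((p : ℂ).re ^ 2 + (p : ℂ).im ^ 2) * h2 + h1
  have hQP : ∀ p, P p * (Q p / P p) = Q p := by
    intro p
    by_cases h : P p = 0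
    · have h3 := hPQ p
      rw [h] at h3
      have : Q p = 0 := by
        have : Q p ^ 2 = 0 := by linarith
        exact pow_eq_zero_iff (two_ne_zero) |>.1 this
      simp [h, this]
    · field_simp
  refine ⟨P, fun p => Q p / P p, ?_, ?_⟩
  · intro p
    have h3 := hPQ p
    nlinarith [sq_nonneg (Q p)]
  · intro p q
    have e : P p * P q * (Q p / P p - Q q / P q) = P q * Q p - P p * Q q := by
      have h1 := hQP p
      have h2 := hQP q
      linear_combination P q * h1 - P p * h2
    rw [e]
    unfold orient
    congr 1
    have h2 := hc k
    simp only [hP, hQ, Complex.mul_im, Complex.sub_im, Complex.sub_re, Complex.conj_re,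
      Complex.conj_im, map_sub]
    linear_combination (- ((p : ℂ).re * (q : ℂ).im - (p : ℂ).im * (q : ℂ).re)) * h2

lemma orient_cyc (a b c : Circle) : orient a b c = orient b c a := by
  unfold orient
  congr 1
  simp only [Complex.mul_im, Complex.sub_im, Complex.sub_re, Complex.conj_re,
      Complex.conj_im, map_sub]
  ring

lemma orient_swap (a b c : Circle) : orient a c b = - orient a b c := by
  unfold orient
  rw [← Real.sign_neg]
  congr 1
  simp only [Complex.mul_im, Complex.sub_im, Complex.sub_re, Complex.conj_re,
      Complex.conj_im, map_sub]
  ring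

lemma orient_values (a b c : Circle) :
    orient a b c = -1 ∨ orient a b c = 0 ∨ orient a b c = 1 := Real.sign_apply_eq _

lemma sign_scaled {P Q d : ℝ} (hP : 0 < P) (hQ : 0 < Q) :
    Real.sign (P * Q * d) = Real.sign d := by
  have h : 0 < P * Q := mul_pos hP hQ
  rcases lt_trichotomy d 0 with hd | hd | hd
  · rw [Real.sign_of_neg hd, Real.sign_of_neg (mul_neg_of_pos_of_neg h hd)]
  · simp [hd]
  · rw [Real.sign_of_pos hd, Real.sign_of_pos (mul_pos h hd)]

/-- Boundedness of the coboundary (weak form of the cocycle identity). -/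
lemma orient_triple (k a b c : Circle) :
    |orient k a b + orient k b c - orient k a c| ≤ 1 := by
  have hv : ∀ a b c, |orient a b c| ≤ 1 := by
    intro a b c
    rcases orient_values a b c with h | h | h <;> rw [h] <;> norm_num
  obtain ⟨P, t, hP, ht⟩ := orient_stereo k
  by_cases ha : P a = 0
  · have h1 : orient k a b = 0 := by rw [ht, ha]; simp
    have h2 : orient k a c = 0 := by rw [ht, ha]; simp
    rw [h1, h2]; simpa using hv k b c
  by_cases hb : P b = 0
  · have h1 : orient k a b = 0 := by rw [ht, hb]; simp
    have h2 : orient k b c = 0 := by rw [ht, hb]; simp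
    rw [h1, h2]; simpa using hv k a c
  by_cases hc : P c = 0
  · have h1 : orient k a c = 0 := by rw [ht, hc]; simp
    have h2 : orient k b c = 0 := by rw [ht, hc]; simp
    rw [h1, h2]; simpa using hv k a b
  have ha' := lt_of_le_of_ne (hP a) (Ne.symm ha)
  have hb' := lt_of_le_of_ne (hP b) (Ne.symm hb)
  have hc' := lt_of_le_of_ne (hP c) (Ne.symm hc)
  rw [ht, ht, ht, sign_scaled ha' hb', sign_scaled hb' hc', sign_scaled ha' hc']
  unfold Real.sign
  split_ifs <;> first | (exfalso; linarith) | norm_num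

/-- The mixed Pfaffian bound. -/
lemma mixed_pfaffian_bound (a b c d e f A B C D E F : ℝ)
    (ha : a = -1 ∨ a = 0 ∨ a = 1) (hb : b = -1 ∨ b = 0 ∨ b = 1) (hc : c = -1 ∨ c = 0 ∨ c = 1)
    (hd : d = -1 ∨ d = 0 ∨ d = 1) (he : e = -1 ∨ e = 0 ∨ e = 1) (hf : f = -1 ∨ f = 0 ∨ f = 1)
    (h1 : |a + d - b| ≤ 1) (h2 : |a + e - c| ≤ 1) (h3 : |b + f - c| ≤ 1) (h4 : |d + f - e| ≤ 1)
    (hA : |A| ≤ 1) (hB : |B| ≤ 1) (hC : |C| ≤ 1) (hD : |D| ≤ 1) (hE : |E| ≤ 1) (hF : |F| ≤ 1)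
    (H1 : |A + D - B| ≤ 1) (H2 : |A + E - C| ≤ 1) (H3 : |B + F - C| ≤ 1)
    (H4 : |D + F - E| ≤ 1) :
    |a * F - b * E + c * D + d * C - e * B + f * A| ≤ 4 := by
  rw [abs_le] at *
  obtain ⟨h1, h1'⟩ := h1
  obtain ⟨h2, h2'⟩ := h2
  obtain ⟨h3, h3'⟩ := h3
  obtain ⟨h4, h4'⟩ := h4
  rcases ha with rfl | rfl | rfl <;> rcases hb with rfl | rfl | rfl <;>
  rcases hd with rfl | rfl | rfl <;> first
  | (exfalso; clear * - h1 h1'; linarith)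
  | (clear h1 h1'
     rcases hc with rfl | rfl | rfl <;> rcases he with rfl | rfl | rfl <;> first
     | (exfalso; clear * - h2 h2'; linarith)
     | (clear h2 h2'
        rcases hf with rfl | rfl | rfl <;> first
        | (exfalso; clear * - h3 h3'; linarith)
        | (exfalso; clear * - h4 h4'; linarith)
        | (clear h3 h3' h4 h4'; constructor <;> linarith)))

/-- Averaging the alternation over cosets of the stabilizer. -/
lemma sum_eq_shift (G : Equiv.Perm (Fin 5) → ℝ) (τ : Equiv.Perm (Fin 5)) :
    ∑ σ, G σ = ∑ σ, G (σ * τ) :=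
  (Equiv.sum_comp (Equiv.mulRight τ) G).symm

lemma theta_le (z : Fin 5 → Circle × Circle) : |Theta z| ≤ 2 / 3 := by
  set G : Equiv.Perm (Fin 5) → ℝ := fun σ => ((Equiv.Perm.sign σ : ℤ) : ℝ) *
      (orient (z (σ 0)).1 (z (σ 1)).1 (z (σ 2)).1 *
        orient (z (σ 2)).2 (z (σ 3)).2 (z (σ 4)).2) with hG
  have key : ∀ (τ : Equiv.Perm (Fin 5)) (s : ℤ) (i j l m : Fin 5),
      ((Equiv.Perm.sign τ : ℤˣ) : ℤ) = s ∧ τ 0 = i ∧ τ 1 = j ∧ τ 2 = 2 ∧ τ 3 = l ∧ τ 4 = m →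
      ∀ σ : Equiv.Perm (Fin 5), G (σ * τ) = ((Equiv.Perm.sign σ : ℤ) : ℝ) * ((s : ℝ) *
        (orient (z (σ 2)).1 (z (σ i)).1 (z (σ j)).1 *
          orient (z (σ 2)).2 (z (σ l)).2 (z (σ m)).2)) := by
    rintro τ s i j l m ⟨hs, h0, h1, h2, h3, h4⟩ σ
    simp only [hG, Equiv.Perm.mul_apply, h0, h1, h2, h3, h4, map_mul, Units.val_mul, hs,
      Int.cast_mul]
    rw [orient_cyc (z (σ 2)).1]
    ring
  have k1 := key 1 1 0 1 3 4 (by decide)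
  have k2 := key (Equiv.swap 1 3) (-1) 0 3 1 4 (by decide)
  have k3 := key (Equiv.swap 1 3 * Equiv.swap 1 4) 1 0 4 1 3 (by decide)
  have k4 := key (Equiv.swap 0 3 * Equiv.swap 0 1) 1 1 3 0 4 (by decide)
  have k5 := key (Equiv.swap 0 3 * Equiv.swap 0 4 * Equiv.swap 0 1) (-1) 1 4 0 3 (by decide)
  have k6 := key (Equiv.swap 0 3 * Equiv.swap 1 4) 1 3 4 0 1 (by decide)
  have hval : ∀ a b c, |orient a b c| ≤ 1 := by
    intro a b c
    rcases orient_values a b c with h | h | h <;> rw [h] <;> norm_num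
  have hsum : 6 * ∑ σ, G σ = ∑ σ, (G (σ * 1) + G (σ * Equiv.swap 1 3) +
      G (σ * (Equiv.swap 1 3 * Equiv.swap 1 4)) + G (σ * (Equiv.swap 0 3 * Equiv.swap 0 1)) +
      G (σ * (Equiv.swap 0 3 * Equiv.swap 0 4 * Equiv.swap 0 1)) +
      G (σ * (Equiv.swap 0 3 * Equiv.swap 1 4))) := by
    simp only [Finset.sum_add_distrib]
    simp only [← sum_eq_shift G]
    ring
  have hbound : |6 * ∑ σ, G σ| ≤ 480 := by
    rw [hsum]
    refine (Finset.abs_sum_le_sum_abs _ _).trans ?_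
    refine (Finset.sum_le_card_nsmul _ _ 4 ?_).trans ?_
    · intro σ _
      rw [k1, k2, k3, k4, k5, k6]
      have hm := mixed_pfaffian_bound _ _ _ _ _ _ _ _ _ _ _ _
        (orient_values (z (σ 2)).1 (z (σ 0)).1 (z (σ 1)).1)
        (orient_values (z (σ 2)).1 (z (σ 0)).1 (z (σ 3)).1)
        (orient_values (z (σ 2)).1 (z (σ 0)).1 (z (σ 4)).1)
        (orient_values (z (σ 2)).1 (z (σ 1)).1 (z (σ 3)).1)
        (orient_values (z (σ 2)).1 (z (σ 1)).1 (z (σ 4)).1)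
        (orient_values (z (σ 2)).1 (z (σ 3)).1 (z (σ 4)).1)
        (orient_triple _ _ _ _) (orient_triple _ _ _ _)
        (orient_triple _ _ _ _) (orient_triple _ _ _ _)
        (hval (z (σ 2)).2 (z (σ 0)).2 (z (σ 1)).2)
        (hval (z (σ 2)).2 (z (σ 0)).2 (z (σ 3)).2)
        (hval (z (σ 2)).2 (z (σ 0)).2 (z (σ 4)).2)
        (hval (z (σ 2)).2 (z (σ 1)).2 (z (σ 3)).2)
        (hval (z (σ 2)).2 (z (σ 1)).2 (z (σ 4)).2)
        (hval (z (σ 2)).2 (z (σ 3)).2 (z (σ 4)).2)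
        (orient_triple _ _ _ _) (orient_triple _ _ _ _)
        (orient_triple _ _ _ _) (orient_triple _ _ _ _)
      have hs : |((Equiv.Perm.sign σ : ℤ) : ℝ)| = 1 := by
        rcases Int.units_eq_one_or (Equiv.Perm.sign σ) with h | h <;> rw [h] <;> simp
      rw [← one_mul |_ - _ + _ + _ - _ + _|, ← hs, ← abs_mul] at hm
      refine le_trans (le_of_eq ?_) hm
      congr 1
      push_cast
      ring
    · rw [Finset.card_univ, Fintype.card_perm, Fintype.card_fin]
      norm_num [Nat.factorial]
  have hT : Theta z = (1 / 120) * ∑ σ, G σ := rfl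
  rw [hT]
  rw [abs_le] at *
  constructor <;> linarith [hbound.1, hbound.2]

/-- Combinatorial orientation of a triple of indices. -/
def orientIdx (i j k : Fin 5) : ℤ :=
  if i < j ∧ j < k ∨ j < k ∧ k < i ∨ k < i ∧ i < j then 1
  else if i < k ∧ k < j ∨ k < j ∧ j < i ∨ j < i ∧ i < k then -1 else 0

lemma orient_idx (x : Fin 5 → Circle) (hx : PosCyclicallyOrdered x) (i j k : Fin 5) :
    orient (x i) (x j) (x k) = (orientIdx i j k : ℝ) := by
  have hself : ∀ a b : Circle, orient a b b = 0 := by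
    intro a b
    have := orient_swap a b b
    linarith
  unfold orientIdx
  split_ifs with h h'
  · rcases h with h | h | h
    · simpa using hx _ _ _ h.1 h.2
    · rw [orient_cyc]; simpa using hx _ _ _ h.1 h.2
    · rw [orient_cyc, orient_cyc]; simpa using hx _ _ _ h.1 h.2
  · rw [orient_swap]
    rcases h' with h | h | h
    · rw [hx _ _ _ h.1 h.2]; simp
    · rw [orient_cyc, hx _ _ _ h.1 h.2]; simp
    · rw [orient_cyc, orient_cyc, hx _ _ _ h.1 h.2]; simp
  · have : i = j ∨ j = k ∨ i = k := by omega
    rcases this with rfl | rfl | rfl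
    · rw [orient_cyc, orient_cyc, hself]; simp
    · rw [hself]; simp
    · rw [orient_cyc, hself]; simp

set_option maxRecDepth 100000 in
lemma idx_sum : ∑ σ : Equiv.Perm (Fin 5), (Equiv.Perm.sign σ : ℤ) *
      (orientIdx (σ 0) (σ 1) (σ 2) *
        orientIdx ((![0, 2, 4, 1, 3] : Fin 5 → Fin 5) (σ 2))
          ((![0, 2, 4, 1, 3] : Fin 5 → Fin 5) (σ 3))
          ((![0, 2, 4, 1, 3] : Fin 5 → Fin 5) (σ 4))) = 80 := by
  decide +kernel

/-- If `x₀, …, x₄` and `y₀, …, y₄` are positively cyclically ordered points of `S¹`, then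
`Θ((x₀,y₀),(x₁,y₂),(x₂,y₄),(x₃,y₁),(x₄,y₃)) = 2/3`; consequently the sup norm of `Θ`
equals `2/3`. -/
theorem theta_extremal_value (x y : Fin 5 → Circle)
    (hx : PosCyclicallyOrdered x) (hy : PosCyclicallyOrdered y) :
    Theta ![(x 0, y 0), (x 1, y 2), (x 2, y 4), (x 3, y 1), (x 4, y 3)] = 2 / 3 ∧
      ∀ z : Fin 5 → Circle × Circle, |Theta z| ≤ 2 / 3 := by
  refine ⟨?_, theta_le⟩
  have hz : (![(x 0, y 0), (x 1, y 2), (x 2, y 4), (x 3, y 1), (x 4, y 3)] :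
      Fin 5 → Circle × Circle) =
      fun i => (x i, y ((![0, 2, 4, 1, 3] : Fin 5 → Fin 5) i)) := by
    funext i
    fin_cases i <;> rfl
  rw [hz]
  unfold Theta
  simp only [orient_idx x hx, orient_idx y hy]
  have h := congrArg (fun n : ℤ => (n : ℝ)) idx_sum
  push_cast at h
  rw [h]
  norm_num
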